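/- If A ∈ KT(Δ⁰₂), then A has a countable lower cone in the K-degrees: the set {B ∈ 2^ω : B ≤_K A} is countable. -/

import Mathlib

/-! Common framework: prefix-free Kolmogorov complexity via a universal
prefix-free oracle machine, Δ⁰₂ functions and orders, Turing and wtt
reducibility, Ω, and the uniform measure on Cantor space. -/

/-- Finite binary strings, `2^{<ω}`. -/
abbrev BinStr := List Bool

/-- Reals, i.e. infinite binary sequences `2^ω`. -/
abbrev Seq2 := ℕ → Bool

/-- The initial segment `A↾n` of a real `A ∈ 2^ω`. -/
def restrict (A : Seq2) (n : ℕ) : BinStr := (List.range n).map A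

/-- A prefix-free oracle machine, presented as a computable enumeration of
axioms `(τ, p, y)`, meaning: on any oracle extending `τ`, the machine halts on
program `p` with output `y`.  Consistency says that for compatible oracle
strings the halting programs form a prefix-free set and outputs are unique. -/
structure PrefixOracleMachine where
  axioms : ℕ → Option (BinStr × BinStr × BinStr)
  axioms_computable : Computable axioms
  consistent : ∀ s t τ₁ p₁ y₁ τ₂ p₂ y₂,
    axioms s = some (τ₁, p₁, y₁) → axioms t = some (τ₂, p₂, y₂) →
    (τ₁ <+: τ₂ ∨ τ₂ <+: τ₁) → p₁ <+: p₂ → p₁ = p₂ ∧ y₁ = y₂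

/-- `M.Computes A p y` : with oracle `A`, machine `M` halts on program `p` with
output `y`. -/
def PrefixOracleMachine.Computes (M : PrefixOracleMachine) (A : Seq2) (p y : BinStr) : Prop :=
  ∃ s τ, M.axioms s = some (τ, p, y) ∧ ∃ n, τ = restrict A n

/-- A universal prefix-free oracle machine: it describes every string (relative
to every oracle), and it simulates every prefix-free oracle machine up to an
additive constant in the length of programs. -/
structure UniversalPrefixMachine extends PrefixOracleMachine where
  total : ∀ (A : Seq2) (y : BinStr), ∃ p, toPrefixOracleMachine.Computes A p y
  universal : ∀ M : PrefixOracleMachine, ∃ c : ℕ, ∀ (A : Seq2) (p y : BinStr),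
    M.Computes A p y →
      ∃ q, toPrefixOracleMachine.Computes A q y ∧ q.length ≤ p.length + c

/-- `K^A(y)` : prefix-free Kolmogorov complexity of `y` relative to oracle `A`. -/
noncomputable def KOr (U : UniversalPrefixMachine) (A : Seq2) (y : BinStr) : ℕ :=
  sInf {n | ∃ p : BinStr, p.length = n ∧ U.toPrefixOracleMachine.Computes A p y}

/-- The all-zeros (recursive) oracle. -/
def zeroSeq : Seq2 := fun _ => false

/-- `K(y)` : (unrelativized) prefix-free Kolmogorov complexity. -/
noncomputable def Kc (U : UniversalPrefixMachine) (y : BinStr) : ℕ := KOr U zeroSeq y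

/-- `K(n)` : the complexity of the string of `n` zeros. -/
noncomputable def KcNat (U : UniversalPrefixMachine) (n : ℕ) : ℕ :=
  Kc U (List.replicate n false)

/-- `A ∈ KT(g)` : `A` is K-trivial up to `g`. -/
def KT (U : UniversalPrefixMachine) (g : ℕ → ℕ) (A : Seq2) : Prop :=
  ∃ c : ℕ, ∀ n : ℕ, Kc U (restrict A n) ≤ KcNat U n + g n + c

/-- `A ∈ LK(f)` : `A` is low for K up to `f`. -/
def LK (U : UniversalPrefixMachine) (f : BinStr → ℕ) (A : Seq2) : Prop :=
  ∃ c : ℕ, ∀ σ : BinStr, Kc U σ ≤ KOr U A σ + f σ + c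

/-- The position of a string in the length-lexicographic ordering of `2^{<ω}`. -/
def strNum (σ : BinStr) : ℕ := σ.foldl (fun n b => 2 * n + (if b then 2 else 1)) 0

/-- A function `ℕ → ℕ` is Δ⁰₂ iff it has a recursive approximation. -/
def Delta02Fun (g : ℕ → ℕ) : Prop :=
  ∃ G : ℕ → ℕ → ℕ, Computable₂ G ∧ ∀ x, ∃ t, ∀ s ≥ t, G s x = g x

/-- A function `2^{<ω} → ℕ` is Δ⁰₂ iff it has a recursive approximation. -/
def Delta02StrFun (f : BinStr → ℕ) : Prop :=
  ∃ F : ℕ → BinStr → ℕ, Computable₂ F ∧ ∀ σ, ∃ t, ∀ s ≥ t, F s σ = f σ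

/-- A real is Δ⁰₂ iff it has a recursive approximation. -/
def Delta02Seq (A : Seq2) : Prop :=
  ∃ F : ℕ → ℕ → Bool, Computable₂ F ∧ ∀ x, ∃ t, ∀ s ≥ t, F s x = A x

/-- An order: an unbounded nondecreasing function `ℕ → ℕ`. -/
def IsOrder (g : ℕ → ℕ) : Prop := Monotone g ∧ ∀ b : ℕ, ∃ m, b < g m

/-- An order on strings: unbounded and nondecreasing with respect to the
length-lexicographic ordering of `2^{<ω}`. -/
def IsStrOrder (f : BinStr → ℕ) : Prop :=
  (∀ σ τ : BinStr, strNum σ ≤ strNum τ → f σ ≤ f τ) ∧ ∀ b : ℕ, ∃ σ, b < f σ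

/-- `A ∈ KT(Δ⁰₂)` : `A` is K-trivial up to every Δ⁰₂ order. -/
def KTDelta (U : UniversalPrefixMachine) (A : Seq2) : Prop :=
  ∀ g : ℕ → ℕ, Delta02Fun g → IsOrder g → KT U g A

/-- `A ∈ LK(Δ⁰₂)` : `A` is low for K up to every Δ⁰₂ order. -/
def LKDelta (U : UniversalPrefixMachine) (A : Seq2) : Prop :=
  ∀ f : BinStr → ℕ, Delta02StrFun f → IsStrOrder f → LK U f A

/-- A Δ⁰₂ function is finite-to-one approximable if it has a recursive
approximation `F` such that for every `n`, for all but finitely many `m`,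
`F s m > n` for all stages `s`. -/
def FinToOneApprox (f : ℕ → ℕ) : Prop :=
  ∃ F : ℕ → ℕ → ℕ, Computable₂ F ∧ (∀ x, ∃ t, ∀ s ≥ t, F s x = f x) ∧
    ∀ n : ℕ, {m : ℕ | ∃ s, F s m ≤ n}.Finite

/-- A Turing functional, presented as a computable enumeration of axioms
`(τ, n, b)`, meaning: on any oracle extending `τ`, the output bit `n` is `b`. -/
structure TuringFunctional where
  axioms : ℕ → Option (BinStr × ℕ × Bool)
  axioms_computable : Computable axioms
  consistent : ∀ s t τ₁ n₁ b₁ τ₂ n₂ b₂,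
    axioms s = some (τ₁, n₁, b₁) → axioms t = some (τ₂, n₂, b₂) →
    (τ₁ <+: τ₂ ∨ τ₂ <+: τ₁) → n₁ = n₂ → b₁ = b₂

/-- `Φ.Computes B A` : `Φ^B = A`. -/
def TuringFunctional.Computes (Φ : TuringFunctional) (B A : Seq2) : Prop :=
  ∀ n : ℕ, ∃ s k, Φ.axioms s = some (restrict B k, n, A n)

/-- Turing reducibility `A ≤_T B`. -/
def TuringLE (A B : Seq2) : Prop := ∃ Φ : TuringFunctional, Φ.Computes B A

/-- Weak truth-table reducibility `A ≤_wtt B` : a Turing reduction whose use is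
bounded by a recursive function. -/
def WttLE (A B : Seq2) : Prop :=
  ∃ (Φ : TuringFunctional) (u : ℕ → ℕ), Computable u ∧
    ∀ n : ℕ, ∃ s k, k ≤ u n ∧ Φ.axioms s = some (restrict B k, n, A n)

/-- The effective join `A ⊕ B`. -/
def join (A B : Seq2) : Seq2 := fun n => if n % 2 = 0 then A (n / 2) else B (n / 2)

/-- `A` is Martin-Löf random: `K(A↾n) ≥ n - c` for all `n`. -/
def MLRandom (U : UniversalPrefixMachine) (A : Seq2) : Prop :=
  ∃ c : ℕ, ∀ n : ℕ, n ≤ Kc U (restrict A n) + c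

/-- `A` is infinitely often K-trivial. -/
def InfOftenKTrivial (U : UniversalPrefixMachine) (A : Seq2) : Prop :=
  ∃ c : ℕ, {n : ℕ | Kc U (restrict A n) ≤ KcNat U n + c}.Infinite

/-- K-reducibility `B ≤_K A`. -/
def KLE (U : UniversalPrefixMachine) (B A : Seq2) : Prop :=
  ∃ c : ℕ, ∀ n : ℕ, Kc U (restrict B n) ≤ Kc U (restrict A n) + c

/-- LK-reducibility `A ≤_LK B`. -/
def LKLE (U : UniversalPrefixMachine) (A B : Seq2) : Prop :=
  ∃ c : ℕ, ∀ σ : BinStr, KOr U B σ ≤ KOr U A σ + c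

/-- `A` is weakly low for K: `K(σ) ≤ K^A(σ) + c` for infinitely many strings σ. -/
def WeaklyLowForK (U : UniversalPrefixMachine) (A : Seq2) : Prop :=
  ∃ c : ℕ, {σ : BinStr | Kc U σ ≤ KOr U A σ + c}.Infinite

/-- Chaitin's Ω : the measure of the domain of the universal machine. -/
noncomputable def Omega (U : UniversalPrefixMachine) : ℝ :=
  ∑' p : {p : BinStr // ∃ y, U.toPrefixOracleMachine.Computes zeroSeq p y},
    ((2 : ℝ) ^ (p : BinStr).length)⁻¹

/-- The `n`-th binary digit of a real number `x`. -/
noncomputable def realBit (x : ℝ) (n : ℕ) : Bool :=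
  decide (⌊x * 2 ^ (n + 1)⌋ % 2 = 1)

/-- `Ω↾n` : the length-`n` initial segment of the binary expansion of Ω. -/
noncomputable def omegaStr (U : UniversalPrefixMachine) (n : ℕ) : BinStr :=
  (List.range n).map (realBit (Omega U))

/-- `A` is low for Ω. -/
def LowForOmega (U : UniversalPrefixMachine) (A : Seq2) : Prop :=
  ∀ c : ℕ, ∃ n : ℕ, KOr U A (omegaStr U n) + c < n

/-- The uniform (coin-flipping) measure on `2^ω`, obtained as the image of
Lebesgue measure on `[0,1]` under the binary-expansion map. -/
noncomputable def cantorMeasure : MeasureTheory.Measure Seq2 :=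
  MeasureTheory.Measure.map (fun x : ℝ => fun n : ℕ => realBit x n)
    (MeasureTheory.volume.restrict (Set.Icc (0 : ℝ) 1))

open scoped Classical in
theorem Primrec.nat_log {b : ℕ} (hb : 1 < b) : Primrec (Nat.log b) := by
  have hp : PrimrecRel fun n i : ℕ => b ^ i ≤ n :=
    Primrec.nat_le.comp ((Primrec₂.unpaired'.1 Nat.Primrec.pow).comp (Primrec.const b) Primrec.snd)
      Primrec.fst
  refine (Primrec.nat_findGreatest Primrec.id hp).of_eq fun n => ?_
  rcases eq_or_ne n 0 with rfl | hn
  · simp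
  · refine le_antisymm ?_ (Nat.le_findGreatest (Nat.log_le_self b n) (Nat.pow_log_le_self b hn))
    refine Nat.le_log_of_pow_le hb ?_
    exact Nat.findGreatest_spec (P := fun i => b ^ i ≤ n) (Nat.zero_le _)
      (by simpa using Nat.one_le_iff_ne_zero.2 hn)

theorem Primrec.nat_pow : Primrec₂ ((· ^ ·) : ℕ → ℕ → ℕ) :=
  Primrec₂.unpaired'.1 Nat.Primrec.pow

theorem Primrec.list_replicate {α : Type*} [Primcodable α] (a : α) :
    Primrec fun n => List.replicate n a :=
  (Primrec.list_map Primrec.list_range (Primrec₂.const a)).of_eq fun n => by simp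

section StrNum

theorem strNum_append_singleton (σ : BinStr) (b : Bool) :
    strNum (σ ++ [b]) = 2 * strNum σ + (if b then 2 else 1) := by
  simp [strNum]

theorem primrec_strNum : Primrec strNum := by
  refine Primrec.list_foldl Primrec.id (Primrec.const 0)
    (Primrec.to₂ (f := fun x : BinStr × (ℕ × Bool) => 2 * x.2.1 + (if x.2.2 then 2 else 1)) ?_)
  have hc : PrimrecPred fun x : BinStr × (ℕ × Bool) => x.2.2 = true :=
    Primrec.eq.comp (Primrec.snd.comp Primrec.snd) (Primrec.const true)
  exact Primrec.nat_add.comp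
    (Primrec.nat_mul.comp (Primrec.const 2) (Primrec.fst.comp Primrec.snd))
    (Primrec.ite hc (Primrec.const 2) (Primrec.const 1))

theorem strNum_injective : Function.Injective strNum := by
  intro σ
  induction σ using List.reverseRecOn with
  | nil =>
    intro τ h
    induction τ using List.reverseRecOn with
    | nil => rfl
    | append_singleton τ c _ =>
      rw [strNum_append_singleton] at h
      cases c <;> simp [strNum] at h
  | append_singleton σ b ih =>
    intro τ h
    induction τ using List.reverseRecOn with
    | nil =>
      rw [strNum_append_singleton] at h
      cases b <;> simp [strNum] at h
    | append_singleton τ c _ =>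
      rw [strNum_append_singleton, strNum_append_singleton] at h
      cases b <;> cases c <;> simp at h
      · rw [ih h]
      · omega
      · omega
      · rw [ih h]

theorem strNum_append_bounds (σ τ : BinStr) :
    (strNum σ + 1) * 2 ^ τ.length ≤ strNum (σ ++ τ) + 1 ∧
      strNum (σ ++ τ) + 2 ≤ (strNum σ + 2) * 2 ^ τ.length := by
  induction τ using List.reverseRecOn with
  | nil => simp
  | append_singleton τ b ih =>
    rw [← List.append_assoc, strNum_append_singleton, List.length_append, pow_add]
    cases b <;> simp <;> constructor <;> nlinarith

theorem strNum_add_two_le (σ : BinStr) : strNum σ + 2 ≤ 2 ^ (σ.length + 1) := by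
  simpa [pow_succ, mul_comm, strNum] using (strNum_append_bounds [] σ).2

theorem exists_strNum_eq (L : ℕ) :
    ∀ v, 2 ^ L ≤ v → v < 2 ^ (L + 1) → ∃ σ : BinStr, σ.length = L ∧ strNum σ + 1 = v := by
  induction L with
  | zero => intro v h₁ h₂; exact ⟨[], rfl, by simp [strNum] at *; omega⟩
  | succ L ih =>
    intro v h₁ h₂
    obtain ⟨σ, hσ, hv⟩ := ih (v / 2) (by rw [pow_succ] at h₁; omega)
      (by rw [pow_succ] at h₂; omega)
    refine ⟨σ ++ [decide (v % 2 = 1)], by simp [hσ], ?_⟩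
    rw [strNum_append_singleton]
    rcases Nat.mod_two_eq_zero_or_one v with h | h <;> simp [h] <;> omega

end StrNum

section Machines

variable (U : UniversalPrefixMachine)

theorem computes_unique {A : Seq2} {p y p' y' : BinStr}
    (h : U.toPrefixOracleMachine.Computes A p y) (h' : U.toPrefixOracleMachine.Computes A p' y')
    (hp : p <+: p') : p = p' ∧ y = y' := by
  obtain ⟨s, τ, hs, n, rfl⟩ := h
  obtain ⟨s', τ', hs', n', rfl⟩ := h'
  refine U.consistent _ _ _ _ _ _ _ _ hs hs' ?_ hp
  have key : ∀ {a b : ℕ}, a ≤ b → restrict A a <+: restrict A b := fun hab =>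
    (List.prefix_iff_eq_take.2 (by simp [List.take_range, hab])).map A
  exact (le_total n n').imp key key

theorem Kc_le_length {p y : BinStr} (h : U.toPrefixOracleMachine.Computes zeroSeq p y) :
    Kc U y ≤ p.length :=
  Nat.sInf_le ⟨p, rfl, h⟩

theorem exists_length_eq_Kc (y : BinStr) :
    ∃ p, U.toPrefixOracleMachine.Computes zeroSeq p y ∧ p.length = Kc U y := by
  obtain ⟨p, hp⟩ := U.total zeroSeq y
  obtain ⟨q, hq, hc⟩ := Nat.sInf_mem
    (s := {n | ∃ p : BinStr, p.length = n ∧ U.toPrefixOracleMachine.Computes zeroSeq p y})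
    ⟨_, p, rfl, hp⟩
  exact ⟨q, hc, hq⟩

/-- A computable prefix-free code bounds `K` up to an additive constant. -/
theorem exists_Kc_le_of_enum (e : ℕ → Option (BinStr × BinStr)) (he : Computable e)
    (hc : ∀ s t p₁ y₁ p₂ y₂, e s = some (p₁, y₁) → e t = some (p₂, y₂) → p₁ <+: p₂ →
      p₁ = p₂ ∧ y₁ = y₂) :
    ∃ C, ∀ s p y, e s = some (p, y) → Kc U y ≤ p.length + C := by
  let M : PrefixOracleMachine :=
    { axioms := fun s => (e s).map fun q => ([], q)
      axioms_computable := Computable.option_map he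
        (Computable.pair (Computable.const []) Computable.snd).to₂
      consistent := by
        intro s t τ₁ p₁ y₁ τ₂ p₂ y₂ h₁ h₂ _ hp
        simp only [Option.map_eq_some_iff, Prod.mk.injEq] at h₁ h₂
        obtain ⟨_, h₁, -, rfl⟩ := h₁
        obtain ⟨_, h₂, -, rfl⟩ := h₂
        exact hc _ _ _ _ _ _ h₁ h₂ hp }
  obtain ⟨C, hC⟩ := U.universal M
  refine ⟨C, fun s p y h => ?_⟩
  obtain ⟨q, hq, hl⟩ := hC zeroSeq p y ⟨s, [], by simp [M, h], 0, rfl⟩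
  exact (Kc_le_length U hq).trans hl

/-- The enumeration of the pairs `(p, y)` with `U(p) = y` relative to the zero oracle. -/
def zeroRun (s : ℕ) : Option (BinStr × BinStr) :=
  (U.axioms s).bind fun x => if true ∈ x.1 then none else some x.2

theorem computable_zeroRun : Computable (zeroRun U) := by
  refine Computable.option_bind U.axioms_computable (Primrec.to_comp ?_)
  have h : PrimrecPred fun x : ℕ × (BinStr × BinStr × BinStr) => true ∈ x.2.1 :=
    ((PrimrecPred.exists_mem_list (p := fun b : Bool => b = true)
      (Primrec.eq.comp Primrec.id (Primrec.const true))).comp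
        (Primrec.fst.comp Primrec.snd)).of_eq fun x => by simp
  exact Primrec.ite h (Primrec.const none)
    (Primrec.option_some.comp (Primrec.snd.comp Primrec.snd))

theorem computes_zeroSeq_iff {p y : BinStr} :
    U.toPrefixOracleMachine.Computes zeroSeq p y ↔ ∃ s, zeroRun U s = some (p, y) := by
  constructor
  · rintro ⟨s, τ, hs, n, rfl⟩
    exact ⟨s, by simp [zeroRun, hs, restrict, zeroSeq]⟩
  · rintro ⟨s, hs⟩
    simp only [zeroRun, Option.bind_eq_some_iff] at hs
    obtain ⟨⟨τ, q⟩, hs, h⟩ := hs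
    split_ifs at h with ht
    obtain rfl : q = (p, y) := by simpa using h
    refine ⟨s, τ, hs, τ.length, ?_⟩
    refine List.ext_getElem (by simp [restrict]) fun i h₁ h₂ => ?_
    have : τ[i] ≠ true := fun h => ht (h ▸ List.getElem_mem h₁)
    simpa [restrict, zeroSeq] using this

end Machines

section Requests

variable (R : ℕ → Option (ℕ × BinStr))

/-- The weight `2⁻ⁿ` of a request for a description of length `n`. -/
noncomputable def requestWeight : Option (ℕ × BinStr) → ℝ
  | none => 0
  | some x => (1 / 2) ^ x.1

/-- The pair `(a, k)` with `a / 2 ^ k = 1 + ∑ t < s, requestWeight (R t)`. -/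
def requestPos : ℕ → ℕ × ℕ
  | 0 => (1, 0)
  | s + 1 => (R s).elim (requestPos s) fun x =>
      ((requestPos s).1 * 2 ^ x.1 + 2 ^ (requestPos s).2, (requestPos s).2 + x.1)

theorem computable_requestPos (hR : Computable R) : Computable (requestPos R) := by
  have hstep : Primrec fun z : (ℕ × ℕ) × (ℕ × BinStr) =>
      (z.1.1 * 2 ^ z.2.1 + 2 ^ z.1.2, z.1.2 + z.2.1) := by
    have ha := Primrec.fst.comp (Primrec.fst (α := ℕ × ℕ) (β := ℕ × BinStr))
    have hk := Primrec.snd.comp (Primrec.fst (α := ℕ × ℕ) (β := ℕ × BinStr))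
    have hn := Primrec.fst.comp (Primrec.snd (α := ℕ × ℕ) (β := ℕ × BinStr))
    exact Primrec.pair
      (Primrec.nat_add.comp
        (Primrec.nat_mul.comp ha (Primrec.nat_pow.comp (Primrec.const 2) hn))
        (Primrec.nat_pow.comp (Primrec.const 2) hk))
      (Primrec.nat_add.comp hk hn)
  have hs : Computable₂ fun (_ : ℕ) (z : ℕ × (ℕ × ℕ)) => (R z.1).elim z.2 fun x =>
      (z.2.1 * 2 ^ x.1 + 2 ^ z.2.2, z.2.2 + x.1) := by
    refine (Computable.option_casesOn
      (hR.comp (Computable.fst.comp Computable.snd)) (Computable.snd.comp Computable.snd)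
      (hstep.to_comp.comp (Computable.pair
        (Computable.snd.comp (Computable.snd.comp Computable.fst)) Computable.snd)).to₂).of_eq ?_
    intro z
    dsimp only
    cases R z.2.1 <;> rfl
  refine (Computable.nat_rec Computable.id (Computable.const ((1, 0) : ℕ × ℕ)) hs).of_eq ?_
  intro s
  induction s with
  | zero => rfl
  | succ s ih =>
    simp only [id_eq] at ih ⊢
    rw [ih, requestPos]

theorem requestPos_eq (s : ℕ) :
    ((requestPos R s).1 : ℝ) / 2 ^ (requestPos R s).2 =
      1 + ∑ t ∈ Finset.range s, requestWeight (R t) := by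
  induction s with
  | zero => simp [requestPos]
  | succ s ih =>
    rw [Finset.sum_range_succ, ← add_assoc, ← ih, requestPos]
    rcases R s with _ | ⟨n, y⟩
    · simp [requestWeight]
    · simp only [Option.elim, requestWeight]
      push_cast
      rw [pow_add, one_div, inv_pow]
      field_simp

theorem requestWeight_nonneg (x : Option (ℕ × BinStr)) : 0 ≤ requestWeight x := by
  cases x <;> simp [requestWeight]

/-- A code word `p` serves the request `(n, y)` at position `(a, k)` if its dyadic interval has
length `2 ^ -(n + 1)` and lies inside the interval allocated to the request. -/
def Serves (p : BinStr) (n : ℕ) (x : ℕ × ℕ) : Prop :=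
  p.length = n + 1 ∧ x.1 * 2 ^ (n + 1) ≤ (strNum p + 1) * 2 ^ x.2 ∧
    (strNum p + 1) * 2 ^ x.2 ≤ x.1 * 2 ^ (n + 1) + 2 ^ x.2

theorem Serves.bounds {p : BinStr} {n : ℕ} {x : ℕ × ℕ} (h : Serves p n x) :
    (x.1 : ℝ) / 2 ^ x.2 ≤ (strNum p + 1) / 2 ^ p.length ∧
      ((strNum p : ℝ) + 2) / 2 ^ p.length ≤ x.1 / 2 ^ x.2 + (1 / 2) ^ n := by
  obtain ⟨hl, h₁, h₂⟩ := h
  have h₁' : (x.1 : ℝ) * 2 ^ (n + 1) ≤ (strNum p + 1) * 2 ^ x.2 := by exact_mod_cast h₁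
  have h₂' : ((strNum p : ℝ) + 1) * 2 ^ x.2 ≤ x.1 * 2 ^ (n + 1) + 2 ^ x.2 := by exact_mod_cast h₂
  rw [hl]
  constructor
  · rwa [div_le_div_iff₀ (by positivity) (by positivity)]
  · rw [one_div, inv_pow, ← one_div, div_add_div _ _ (by positivity) (by positivity),
      div_le_div_iff₀ (by positivity) (by positivity)]
    have := mul_le_mul_of_nonneg_right h₂' (by positivity : (0 : ℝ) ≤ 2 ^ n)
    rw [pow_succ] at *
    nlinarith

theorem exists_serves {n a k : ℕ} (h₁ : (1 : ℝ) ≤ a / 2 ^ k)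
    (h₂ : (a : ℝ) / 2 ^ k + (1 / 2) ^ n ≤ 2) : ∃ p, Serves p n (a, k) := by
  set X : ℝ := a / 2 ^ k with hX
  have hpow : (0 : ℝ) < 2 ^ (n + 1) := by positivity
  have hXn : (a : ℝ) * 2 ^ (n + 1) = X * 2 ^ (n + 1) * 2 ^ k := by
    rw [hX]; field_simp
  have hle := Nat.le_ceil (X * 2 ^ (n + 1))
  have hlt := Nat.ceil_lt_add_one (a := X * 2 ^ (n + 1)) (by positivity)
  obtain ⟨p, hp, hv⟩ := exists_strNum_eq (n + 1) ⌈X * 2 ^ (n + 1)⌉₊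
    (by
      have : (2 : ℝ) ^ (n + 1) ≤ ⌈X * 2 ^ (n + 1)⌉₊ := by nlinarith
      exact_mod_cast this)
    (by
      have h₃ := mul_le_mul_of_nonneg_right h₂ hpow.le
      have h₄ : ((1 : ℝ) / 2) ^ n * 2 ^ (n + 1) = 2 := by
        rw [pow_succ, ← mul_assoc, ← mul_pow]; norm_num
      have : (⌈X * 2 ^ (n + 1)⌉₊ : ℝ) < 2 ^ (n + 1 + 1) := by
        rw [pow_succ _ (n + 1)]; nlinarith
      exact_mod_cast this)
  refine ⟨p, hp, ?_, ?_⟩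
  · rw [hv]
    have : (a : ℝ) * 2 ^ (n + 1) ≤ ⌈X * 2 ^ (n + 1)⌉₊ * 2 ^ k := by rw [hXn]; gcongr
    exact_mod_cast this
  · rw [hv]
    have : (⌈X * 2 ^ (n + 1)⌉₊ : ℝ) * 2 ^ k ≤ a * 2 ^ (n + 1) + 2 ^ k := by
      rw [hXn, ← add_one_mul]; gcongr
    exact_mod_cast this

theorem primrecPred_serves : PrimrecPred fun z : BinStr × ℕ × (ℕ × ℕ) =>
    Serves z.1 z.2.1 z.2.2 := by
  have hp := Primrec.fst (α := BinStr) (β := ℕ × (ℕ × ℕ))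
  have hn := Primrec.fst.comp (Primrec.snd (α := BinStr) (β := ℕ × (ℕ × ℕ)))
  have ha := Primrec.fst.comp (Primrec.snd.comp (Primrec.snd (α := BinStr) (β := ℕ × (ℕ × ℕ))))
  have hk := Primrec.snd.comp (Primrec.snd.comp (Primrec.snd (α := BinStr) (β := ℕ × (ℕ × ℕ))))
  have hn₁ := Primrec.succ.comp hn
  have hpow := Primrec.nat_pow.comp (Primrec.const 2) hk
  have hv := Primrec.nat_mul.comp (Primrec.succ.comp (primrec_strNum.comp hp)) hpow
  have hx := Primrec.nat_mul.comp ha (Primrec.nat_pow.comp (Primrec.const 2) hn₁)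
  exact (Primrec.eq.comp (Primrec.list_length.comp hp) hn₁).and
    ((Primrec.nat_le.comp hx hv).and (Primrec.nat_le.comp hv (Primrec.nat_add.comp hx hpow)))

open scoped Classical in
/-- **Kraft–Chaitin theorem**: a computable sequence of requests `(n, y)` of total weight at most
one bounds `K(y)` by `n` up to an additive constant. -/
theorem exists_Kc_le_of_requests (U : UniversalPrefixMachine) (hR : Computable R)
    (hw : ∀ s, ∑ t ∈ Finset.range s, requestWeight (R t) ≤ 1) :
    ∃ C, ∀ t n y, R t = some (n, y) → Kc U y ≤ n + C := by
  let e : ℕ → Option (BinStr × BinStr) := fun s =>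
    (Encodable.decode (α := BinStr) s.unpair.2).bind fun p => (R s.unpair.1).bind fun x =>
      if Serves p x.1 (requestPos R s.unpair.1) then some (p, x.2) else none
  have he : Computable e := by
    have h₁ : Computable fun s : ℕ => s.unpair.1 := Computable.fst.comp Computable.unpair
    have h₂ : Computable fun s : ℕ => s.unpair.2 := Computable.snd.comp Computable.unpair
    have hG : Primrec fun z : BinStr × (ℕ × BinStr) × (ℕ × ℕ) =>
        if Serves z.1 z.2.1.1 z.2.2 then some (z.1, z.2.1.2) else none := by
      refine Primrec.ite (primrecPred_serves.comp (f := fun z : BinStr × (ℕ × BinStr) × (ℕ × ℕ) =>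
        (z.1, z.2.1.1, z.2.2)) ?_) (Primrec.option_some.comp ?_) (Primrec.const none)
      · exact Primrec.pair Primrec.fst (Primrec.pair
          (Primrec.fst.comp (Primrec.fst.comp Primrec.snd)) (Primrec.snd.comp Primrec.snd))
      · exact Primrec.pair Primrec.fst (Primrec.snd.comp (Primrec.fst.comp Primrec.snd))
    have hin : Computable fun z : ℕ × BinStr => (R z.1.unpair.1).bind fun x =>
        if Serves z.2 x.1 (requestPos R z.1.unpair.1) then some (z.2, x.2) else none := by
      refine Computable.option_bind (hR.comp (h₁.comp Computable.fst)) ?_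
      exact (hG.to_comp.comp (Computable.pair (Computable.snd.comp Computable.fst)
        (Computable.pair Computable.snd ((computable_requestPos R hR).comp
          (h₁.comp (Computable.fst.comp Computable.fst)))))).to₂
    exact Computable.option_bind (Computable.decode.comp h₂) hin.to₂
  let X : ℕ → ℝ := fun s => 1 + ∑ t ∈ Finset.range s, requestWeight (R t)
  have hXmono : Monotone X := by
    refine monotone_nat_of_le_succ fun s => ?_
    simp only [X, Finset.sum_range_succ]
    linarith [requestWeight_nonneg (R s)]
  have hspec : ∀ {s p y}, e s = some (p, y) → ∃ n, R s.unpair.1 = some (n, y) ∧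
      p.length = n + 1 ∧ X s.unpair.1 ≤ (strNum p + 1) / 2 ^ p.length ∧
        ((strNum p : ℝ) + 2) / 2 ^ p.length ≤ X (s.unpair.1 + 1) := by
    intro s p y h
    simp only [e, Option.bind_eq_some_iff] at h
    obtain ⟨q, -, ⟨n, z⟩, hR', h⟩ := h
    split_ifs at h with hs
    simp only [Option.some.injEq, Prod.mk.injEq] at h
    obtain ⟨rfl, rfl⟩ := h
    have hb := hs.bounds
    rw [requestPos_eq] at hb
    refine ⟨n, hR', hs.1, hb.1, hb.2.trans_eq ?_⟩
    simp only [X, Finset.sum_range_succ, hR', requestWeight, add_assoc]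
  have hlt : ∀ p : BinStr, ((strNum p : ℝ) + 1) / 2 ^ p.length < (strNum p + 2) / 2 ^ p.length :=
    fun p => by gcongr; norm_num
  obtain ⟨C, hC⟩ := exists_Kc_le_of_enum U e he (by
    intro s t p₁ y₁ p₂ y₂ h₁ h₂ hp
    obtain ⟨n₁, hR₁, hl₁, ha₁, hb₁⟩ := hspec h₁
    obtain ⟨n₂, hR₂, hl₂, ha₂, hb₂⟩ := hspec h₂
    obtain ⟨q, rfl⟩ := hp
    have hnest₁ : ((strNum p₁ : ℝ) + 1) / 2 ^ p₁.length ≤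
        (strNum (p₁ ++ q) + 1) / 2 ^ (p₁ ++ q).length := by
      rw [List.length_append, pow_add, div_le_div_iff₀ (by positivity) (by positivity)]
      have : ((strNum p₁ : ℝ) + 1) * 2 ^ q.length ≤ strNum (p₁ ++ q) + 1 := by
        exact_mod_cast (strNum_append_bounds p₁ q).1
      have := mul_le_mul_of_nonneg_right this (by positivity : (0 : ℝ) ≤ 2 ^ p₁.length)
      linarith
    have hnest₂ : ((strNum (p₁ ++ q) : ℝ) + 2) / 2 ^ (p₁ ++ q).length ≤
        (strNum p₁ + 2) / 2 ^ p₁.length := by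
      rw [List.length_append, pow_add, div_le_div_iff₀ (by positivity) (by positivity)]
      have : (strNum (p₁ ++ q) : ℝ) + 2 ≤ (strNum p₁ + 2) * 2 ^ q.length := by
        exact_mod_cast (strNum_append_bounds p₁ q).2
      have := mul_le_mul_of_nonneg_right this (by positivity : (0 : ℝ) ≤ 2 ^ p₁.length)
      linarith
    rcases lt_trichotomy s.unpair.1 t.unpair.1 with hst | hst | hst
    · linarith [hXmono (Nat.succ_le_of_lt hst), hlt (p₁ ++ q)]
    · rw [hst, hR₂] at hR₁
      simp only [Option.some.injEq, Prod.mk.injEq] at hR₁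
      obtain ⟨rfl, rfl⟩ := hR₁
      rw [List.length_append] at hl₂
      simp [List.length_eq_zero_iff.1 (show q.length = 0 by omega)]
    · linarith [hXmono (Nat.succ_le_of_lt hst), hlt (p₁ ++ q)])
  refine ⟨C + 1, fun t n y h => ?_⟩
  obtain ⟨p, hp⟩ := exists_serves (n := n) (a := (requestPos R t).1) (k := (requestPos R t).2)
    (by
      rw [requestPos_eq]
      linarith [Finset.sum_nonneg fun i (_ : i ∈ Finset.range t) => requestWeight_nonneg (R i)])
    (by
      rw [requestPos_eq]
      have := hw (t + 1)
      rw [Finset.sum_range_succ, h] at this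
      change _ + (1 / 2 : ℝ) ^ n ≤ 1 at this
      linarith)
  have := hC (Nat.pair t (Encodable.encode p)) p y (by simp [e, h, hp])
  have := hp.1
  omega

end Requests

section Counting

/-- The lengths of a program and of its output. -/
def lengthPair (x : BinStr × BinStr) : ℕ × ℕ := (x.1.length, x.2.length)

/-- The number of entries of `l` with program length and output length given by `c`. -/
def classCount (c : ℕ × ℕ) (l : List (BinStr × BinStr)) : ℕ :=
  (l.filter fun x => lengthPair x = c).length

theorem classCount_cons (c : ℕ × ℕ) (x : BinStr × BinStr) (l : List (BinStr × BinStr)) :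
    classCount c (x :: l) = classCount c l + if lengthPair x = c then 1 else 0 := by
  unfold classCount
  rw [List.filter_cons]
  split_ifs <;> simp_all

theorem primrec_lengthPair : Primrec lengthPair :=
  Primrec.pair (Primrec.list_length.comp Primrec.fst) (Primrec.list_length.comp Primrec.snd)

theorem primrec_classCount : Primrec₂ classCount := by
  have h : PrimrecRel fun (x : BinStr × BinStr) (c : ℕ × ℕ) => lengthPair x = c :=
    Primrec.eq.comp (primrec_lengthPair.comp Primrec.fst) Primrec.snd
  exact Primrec.list_length.comp (h.listFilter.comp Primrec.snd Primrec.fst)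

/-- The weight earned by the `N`-th program of a class. -/
noncomputable def powerWeight (N : ℕ) : ℝ := if 2 ^ Nat.log 2 N = N then N / 2 else 0

theorem sum_powerWeight_le_of_lt (T : ℕ) :
    ∀ k, T < 2 ^ k → ∑ N ∈ Finset.range T, powerWeight (N + 1) ≤ (2 ^ k - 1) / 2 := by
  induction T with
  | zero =>
    intro k _
    have : (1 : ℝ) ≤ 2 ^ k := one_le_pow₀ (by norm_num)
    simp only [Finset.range_zero, Finset.sum_empty]
    linarith
  | succ T ih =>
    intro k hk
    rw [Finset.sum_range_succ, powerWeight]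
    split_ifs with h
    · set i := Nat.log 2 (T + 1)
      have hi := ih i (by omega)
      have hik : i + 1 ≤ k := (Nat.pow_lt_pow_iff_right (by norm_num : 1 < 2)).1 (h ▸ hk)
      have hk' : (2 : ℝ) ^ (i + 1) ≤ 2 ^ k := pow_le_pow_right₀ (by norm_num) hik
      have h' : ((T + 1 : ℕ) : ℝ) = 2 ^ i := by exact_mod_cast h.symm
      rw [h']
      rw [pow_succ] at hk'
      linarith
    · linarith [ih k (by omega)]

theorem sum_powerWeight_le (T : ℕ) : ∑ N ∈ Finset.range T, powerWeight (N + 1) ≤ T := by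
  rcases Nat.eq_zero_or_pos T with rfl | hT
  · simp
  · have h := sum_powerWeight_le_of_lt T _ (Nat.lt_pow_succ_log_self (by norm_num : 1 < 2) T)
    have hle : (2 : ℝ) ^ Nat.log 2 T ≤ T := by exact_mod_cast Nat.pow_log_le_self 2 hT.ne'
    rw [pow_succ] at h
    linarith

/-- The total weight earned by the programs of `l`, the last entry being the earliest. -/
noncomputable def earned : List (BinStr × BinStr) → ℝ
  | [] => 0
  | x :: l => earned l + powerWeight (classCount (lengthPair x) l + 1) * (1 / 2) ^ x.1.length

theorem earned_eq_sum (C : Finset (ℕ × ℕ)) (l : List (BinStr × BinStr))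
    (hC : ∀ x ∈ l, lengthPair x ∈ C) :
    earned l = ∑ c ∈ C,
      (∑ N ∈ Finset.range (classCount c l), powerWeight (N + 1)) * (1 / 2) ^ c.1 := by
  induction l with
  | nil => simp [earned, classCount]
  | cons x l ih =>
    rw [earned, ih fun y hy => hC y (List.mem_cons_of_mem _ hy)]
    have hterm : ∀ c ∈ C,
        (∑ N ∈ Finset.range (classCount c (x :: l)), powerWeight (N + 1)) * (1 / 2 : ℝ) ^ c.1 =
        (∑ N ∈ Finset.range (classCount c l), powerWeight (N + 1)) * (1 / 2) ^ c.1 +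
          if lengthPair x = c then powerWeight (classCount c l + 1) * (1 / 2) ^ c.1 else 0 := by
      intro c _
      rw [classCount_cons]
      split_ifs
      · rw [Finset.sum_range_succ, add_mul]
      · simp
    rw [Finset.sum_congr rfl hterm, Finset.sum_add_distrib, Finset.sum_ite_eq,
      if_pos (hC x List.mem_cons_self)]
    rfl

theorem sum_map_eq_sum_classCount (C : Finset (ℕ × ℕ)) (l : List (BinStr × BinStr))
    (hC : ∀ x ∈ l, lengthPair x ∈ C) :
    (l.map fun x => (1 / 2 : ℝ) ^ x.1.length).sum =
      ∑ c ∈ C, (classCount c l : ℝ) * (1 / 2) ^ c.1 := by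
  induction l with
  | nil => simp [classCount]
  | cons x l ih =>
    rw [List.map_cons, List.sum_cons, ih fun y hy => hC y (List.mem_cons_of_mem _ hy)]
    have hterm : ∀ c ∈ C, (classCount c (x :: l) : ℝ) * (1 / 2 : ℝ) ^ c.1 =
        (if lengthPair x = c then (1 / 2) ^ c.1 else 0) + classCount c l * (1 / 2) ^ c.1 := by
      intro c _
      rw [classCount_cons]
      split_ifs <;> push_cast <;> ring
    rw [Finset.sum_congr rfl hterm, Finset.sum_add_distrib, Finset.sum_ite_eq,
      if_pos (hC x List.mem_cons_self)]
    rfl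

theorem earned_le (l : List (BinStr × BinStr)) :
    earned l ≤ (l.map fun x => (1 / 2 : ℝ) ^ x.1.length).sum := by
  have hC : ∀ x ∈ l, lengthPair x ∈ (l.map lengthPair).toFinset := fun x hx =>
    List.mem_toFinset.2 (List.mem_map_of_mem hx)
  rw [earned_eq_sum _ l hC, sum_map_eq_sum_classCount _ l hC]
  exact Finset.sum_le_sum fun c _ =>
    mul_le_mul_of_nonneg_right (sum_powerWeight_le _) (by positivity)

/-- **Kraft's inequality** for prefix-free sets of strings. -/
theorem sum_half_pow_length_le_one (S : Finset BinStr)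
    (hS : ∀ p ∈ S, ∀ q ∈ S, p <+: q → p = q) : ∑ p ∈ S, (1 / 2 : ℝ) ^ p.length ≤ 1 := by
  by_cases hnil : ([] : BinStr) ∈ S
  · have : S = {[]} := Finset.eq_singleton_iff_unique_mem.2
      ⟨hnil, fun p hp => (hS _ hnil p hp List.nil_prefix).symm⟩
    simp [this]
  · have hud : InformationTheory.UniquelyDecodable (S : Set BinStr) := by
      intro L₁
      induction L₁ with
      | nil =>
        intro L₂ _ h₂ h
        cases L₂ with
        | nil => rfl
        | cons w L₂ =>
          have : w = [] := by
            simp only [List.flatten_nil, List.flatten_cons] at h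
            exact (List.append_eq_nil_iff.1 h.symm).1
          exact absurd (h₂ w List.mem_cons_self) (this ▸ hnil)
      | cons v L₁ ih =>
        intro L₂ h₁ h₂ h
        cases L₂ with
        | nil =>
          have : v = [] := by
            simp only [List.flatten_nil, List.flatten_cons] at h
            exact (List.append_eq_nil_iff.1 h).1
          exact absurd (h₁ v List.mem_cons_self) (this ▸ hnil)
        | cons w L₂ =>
          simp only [List.flatten_cons] at h
          have hv := h₁ v List.mem_cons_self
          have hw := h₂ w List.mem_cons_self
          have hvw : v = w := by
            rcases List.prefix_or_prefix_of_prefix (List.prefix_append v L₁.flatten)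
              (h ▸ List.prefix_append w L₂.flatten) with hp | hp
            · exact hS v hv w hw hp
            · exact (hS w hw v hv hp).symm
          subst hvw
          rw [ih L₂ (fun x hx => h₁ x (List.mem_cons_of_mem _ hx))
            (fun x hx => h₂ x (List.mem_cons_of_mem _ hx)) (List.append_cancel_left h)]
    simpa using InformationTheory.kraft_mcmillan_inequality hud

variable (U : UniversalPrefixMachine)

/-- The distinct pairs `(p, y)` enumerated by `zeroRun U` before stage `s`, latest first. -/
def history : ℕ → List (BinStr × BinStr)
  | 0 => []
  | s + 1 => (zeroRun U s).elim (history s) fun x =>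
      if x ∈ history s then history s else x :: history s

theorem primrecRel_mem {α : Type*} [Primcodable α] :
    PrimrecRel fun (x : α) (l : List α) => x ∈ l :=
  ((PrimrecRel.exists_mem_list (R := fun a b : α => a = b) Primrec.eq).comp
    Primrec.snd Primrec.fst).of_eq fun z => by simp

theorem computable_history : Computable (history U) := by
  classical
  have hstep : Primrec fun z : List (BinStr × BinStr) × (BinStr × BinStr) =>
      if z.2 ∈ z.1 then z.1 else z.2 :: z.1 :=
    Primrec.ite (primrecRel_mem.comp Primrec.snd Primrec.fst) Primrec.fst
      (Primrec.list_cons.comp Primrec.snd Primrec.fst)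
  have hs : Computable₂ fun (_ : ℕ) (z : ℕ × List (BinStr × BinStr)) =>
      (zeroRun U z.1).elim z.2 fun x => if x ∈ z.2 then z.2 else x :: z.2 := by
    refine (Computable.option_casesOn
      ((computable_zeroRun U).comp (Computable.fst.comp Computable.snd))
      (Computable.snd.comp Computable.snd)
      (hstep.to_comp.comp (Computable.pair
        (Computable.snd.comp (Computable.snd.comp Computable.fst)) Computable.snd)).to₂).of_eq ?_
    intro z
    dsimp only
    cases zeroRun U z.2.1
    · rfl
    · simp
  refine (Computable.nat_rec Computable.id
    (Computable.const ([] : List (BinStr × BinStr))) hs).of_eq ?_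
  intro s
  induction s with
  | zero => rfl
  | succ s ih =>
    simp only [id_eq] at ih ⊢
    rw [ih, history]

theorem history_succ_eq (s : ℕ) :
    history U (s + 1) = history U s ∨
      ∃ x, zeroRun U s = some x ∧ x ∉ history U s ∧ history U (s + 1) = x :: history U s := by
  rw [history]
  cases h : zeroRun U s with
  | none => exact Or.inl rfl
  | some x =>
    by_cases hx : x ∈ history U s
    · simp [hx]
    · exact Or.inr ⟨x, rfl, hx, by simp [hx]⟩

theorem history_mono {s t : ℕ} (h : s ≤ t) {x : BinStr × BinStr} (hx : x ∈ history U s) :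
    x ∈ history U t := by
  induction t, h using Nat.le_induction with
  | base => exact hx
  | succ t _ ih =>
    rcases history_succ_eq U t with h | ⟨y, -, -, h⟩ <;> rw [h]
    · exact ih
    · exact List.mem_cons_of_mem _ ih

theorem mem_history_succ {s : ℕ} {x : BinStr × BinStr} (h : zeroRun U s = some x) :
    x ∈ history U (s + 1) := by
  rw [history, h]
  by_cases hx : x ∈ history U s <;> simp [hx]

theorem computes_of_mem_history {s : ℕ} {x : BinStr × BinStr} (h : x ∈ history U s) :
    U.toPrefixOracleMachine.Computes zeroSeq x.1 x.2 := by
  induction s with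
  | zero => simp [history] at h
  | succ s ih =>
    rcases history_succ_eq U s with h' | ⟨y, hy, -, h'⟩ <;> rw [h'] at h
    · exact ih h
    · rcases List.mem_cons.1 h with rfl | h
      · exact (computes_zeroSeq_iff U).2 ⟨s, hy⟩
      · exact ih h

theorem nodup_history (s : ℕ) : (history U s).Nodup := by
  induction s with
  | zero => exact List.nodup_nil
  | succ s ih =>
    rcases history_succ_eq U s with h | ⟨x, -, hx, h⟩ <;> rw [h]
    · exact ih
    · exact List.nodup_cons.2 ⟨hx, ih⟩

theorem earned_history_le_one (s : ℕ) : earned (history U s) ≤ 1 := by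
  refine (earned_le _).trans ?_
  have hinj : ∀ x ∈ history U s, ∀ y ∈ history U s, x.1 <+: y.1 → x = y := fun x hx y hy h =>
    Prod.ext_iff.2 (computes_unique U (computes_of_mem_history U hx)
      (computes_of_mem_history U hy) h)
  have hnd : ((history U s).map Prod.fst).Nodup :=
    (nodup_history U s).map_on fun x hx y hy h => hinj x hx y hy (h ▸ List.prefix_rfl)
  have := sum_half_pow_length_le_one ((history U s).map Prod.fst).toFinset (by
    simp only [List.mem_toFinset, List.mem_map]
    rintro _ ⟨x, hx, rfl⟩ _ ⟨y, hy, rfl⟩ h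
    rw [hinj x hx y hy h])
  rwa [List.sum_toFinset _ hnd, List.map_map] at this

/-- Whenever the number of programs of length `L` with output of length `m` reaches `2 ^ i`,
request a description of `m` of length `L + 1 - i`. -/
def countRequest (s : ℕ) : Option (ℕ × BinStr) :=
  (zeroRun U s).bind fun x =>
    if x ∉ history U s ∧ 2 ^ Nat.log 2 (classCount (lengthPair x) (history U s) + 1) =
        classCount (lengthPair x) (history U s) + 1 then
      some (x.1.length + 1 - Nat.log 2 (classCount (lengthPair x) (history U s) + 1),
        List.replicate x.2.length false)
    else none

theorem computable_countRequest : Computable (countRequest U) := by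
  classical
  have hc : Primrec fun z : (BinStr × BinStr) × List (BinStr × BinStr) =>
      classCount (lengthPair z.1) z.2 + 1 :=
    Primrec.succ.comp (primrec_classCount.comp (primrec_lengthPair.comp Primrec.fst) Primrec.snd)
  have hl := (Primrec.nat_log one_lt_two).comp hc
  have hG : Primrec fun z : (BinStr × BinStr) × List (BinStr × BinStr) =>
      if z.1 ∉ z.2 ∧ 2 ^ Nat.log 2 (classCount (lengthPair z.1) z.2 + 1) =
          classCount (lengthPair z.1) z.2 + 1 then
        some (z.1.1.length + 1 - Nat.log 2 (classCount (lengthPair z.1) z.2 + 1),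
          List.replicate z.1.2.length false)
      else none := by
    refine Primrec.ite ((primrecRel_mem.comp Primrec.fst Primrec.snd).not.and
      (Primrec.eq.comp (Primrec.nat_pow.comp (Primrec.const 2) hl) hc))
      (Primrec.option_some.comp (Primrec.pair (Primrec.nat_sub.comp (Primrec.succ.comp
        (Primrec.list_length.comp (Primrec.fst.comp Primrec.fst))) hl)
        ((Primrec.list_replicate false).comp
          (Primrec.list_length.comp (Primrec.snd.comp Primrec.fst))))) (Primrec.const none)
  refine (Computable.option_bind (computable_zeroRun U) (hG.to_comp.comp (Computable.pair
    Computable.snd ((computable_history U).comp Computable.fst))).to₂).of_eq fun s => ?_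
  unfold countRequest
  congr! 3

theorem sum_countRequest_le (s : ℕ) :
    ∑ t ∈ Finset.range s, requestWeight (countRequest U t) ≤ earned (history U s) := by
  induction s with
  | zero => simp [history, earned]
  | succ s ih =>
    rw [Finset.sum_range_succ]
    cases h : zeroRun U s with
    | none =>
      have h₁ : countRequest U s = none := by simp [countRequest, h]
      have h₂ : history U (s + 1) = history U s := by simp [history, h]
      simpa [h₁, h₂, requestWeight] using ih
    | some x =>
      by_cases hx : x ∈ history U s
      · have h₁ : countRequest U s = none := by simp [countRequest, h, hx]
        have h₂ : history U (s + 1) = history U s := by simp [history, h, hx]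
        simpa [h₁, h₂, requestWeight] using ih
      · have h₂ : history U (s + 1) = x :: history U s := by simp [history, h, hx]
        rw [h₂, earned]
        refine add_le_add ih ?_
        simp only [countRequest, h, Option.bind_some, hx, not_false_eq_true, true_and, powerWeight]
        generalize classCount (lengthPair x) (history U s) + 1 = N
        split_ifs with hN
        · change (1 / 2 : ℝ) ^ (x.1.length + 1 - Nat.log 2 N) ≤ _
          set i := Nat.log 2 N
          have hN' : (N : ℝ) = 2 ^ i := by exact_mod_cast hN.symm
          have hle : x.1.length + 1 ≤ (x.1.length + 1 - i) + i := by omega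
          have h₃ : (1 / 2 : ℝ) ^ ((x.1.length + 1 - i) + i) ≤ (1 / 2) ^ (x.1.length + 1) :=
            pow_le_pow_of_le_one (by norm_num) (by norm_num) hle
          have h₄ : (1 / 2 : ℝ) ^ i * 2 ^ i = 1 := by rw [← mul_pow]; norm_num
          have h₅ := mul_le_mul_of_nonneg_right h₃ (by positivity : (0 : ℝ) ≤ 2 ^ i)
          rw [pow_add, mul_assoc, h₄, mul_one, pow_succ] at h₅
          rw [hN']
          linarith
        · simp [requestWeight]

/-- If `2 ^ i` programs of length `L` have outputs of length `m`, then `K(m) ≤ L + 1 - i + C`. -/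
theorem exists_KcNat_le_of_two_pow_le_card : ∃ C, ∀ (L m i : ℕ) (P : Finset BinStr),
    (∀ p ∈ P, p.length = L ∧
      ∃ y : BinStr, y.length = m ∧ U.toPrefixOracleMachine.Computes zeroSeq p y) →
    2 ^ i ≤ P.card → KcNat U m ≤ L + 1 - i + C := by
  obtain ⟨C, hC⟩ := exists_Kc_le_of_requests (countRequest U) U (computable_countRequest U)
    fun s => (sum_countRequest_le U s).trans (earned_history_le_one U s)
  refine ⟨C, fun L m i P hP hi => ?_⟩
  have hex : ∃ s, 2 ^ i ≤ classCount (L, m) (history U s) := by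
    choose! y hy using fun p hp => (hP p hp).2
    choose! t ht using fun p hp => (computes_zeroSeq_iff U).1 (hy p hp).2
    refine ⟨P.sup t + 1, hi.trans ?_⟩
    rw [← Finset.card_image_of_injective P (f := fun p => (p, y p))
      fun p q h => (Prod.mk.inj h).1]
    refine (Finset.card_le_card fun x hx => ?_).trans (List.toFinset_card_le _)
    obtain ⟨p, hp, rfl⟩ := Finset.mem_image.1 hx
    rw [List.mem_toFinset, List.mem_filter]
    refine ⟨history_mono U (Nat.succ_le_succ (Finset.le_sup hp))
      (mem_history_succ U (ht p hp)), ?_⟩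
    simp [lengthPair, (hP p hp).1, (hy p hp).1]
  obtain ⟨s, hs⟩ : ∃ s, classCount (L, m) (history U s) < 2 ^ i ∧
      2 ^ i ≤ classCount (L, m) (history U (s + 1)) := by
    classical
    have hpos : Nat.find hex ≠ 0 := fun h0 => by
      have := Nat.find_spec hex
      rw [h0] at this
      simp [history, classCount] at this
    obtain ⟨s, hs⟩ := Nat.exists_eq_succ_of_ne_zero hpos
    exact ⟨s, not_le.1 (Nat.find_min hex (by omega)), by
      have h := Nat.find_spec hex
      rwa [hs] at h⟩
  rcases history_succ_eq U s with h | ⟨x, hx, hnew, h⟩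
  · rw [h] at hs; omega
  · rw [h, classCount_cons] at hs
    split_ifs at hs with hcl
    · have hcount : classCount (L, m) (history U s) + 1 = 2 ^ i := by omega
      have hL : x.1.length = L := congrArg Prod.fst hcl
      have hm : x.2.length = m := congrArg Prod.snd hcl
      refine hC s (L + 1 - i) _ ?_
      simp [countRequest, hx, hnew, hcl, hcount, hL, hm, Nat.log_pow]
    · omega

/-- **Counting theorem**: the number of strings `σ` of length `m` with `K(σ) ≤ K(m) + c` is
bounded independently of `m`. -/
theorem exists_card_le_of_Kc_le (c : ℕ) : ∃ D, ∀ (m : ℕ) (S : Finset BinStr),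
    (∀ σ ∈ S, σ.length = m ∧ Kc U σ ≤ KcNat U m + c) → S.card ≤ D := by
  obtain ⟨C, hC⟩ := exists_KcNat_le_of_two_pow_le_card U
  refine ⟨2 ^ (c + C + 2) * (c + C + 2), fun m S hS => ?_⟩
  choose f hf hfl using exists_length_eq_Kc U
  have hfinj : Function.Injective f := fun σ τ h =>
    (computes_unique U (hf σ) (hf τ) (h ▸ List.prefix_rfl)).2
  have hfiber : ∀ L i, 2 ^ i ≤ (S.filter fun σ => Kc U σ = L).card →
      KcNat U m ≤ L + 1 - i + C := by
    intro L i hi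
    refine hC L m i ((S.filter fun σ => Kc U σ = L).image f) ?_
      (by rwa [Finset.card_image_of_injective _ hfinj])
    intro p hp
    obtain ⟨σ, hσ, rfl⟩ := Finset.mem_image.1 hp
    obtain ⟨hσS, rfl⟩ := Finset.mem_filter.1 hσ
    exact ⟨hfl σ, σ, (hS σ hσS).1, hf σ⟩
  have hlen : ∀ L i, 2 ^ i ≤ (S.filter fun σ => Kc U σ = L).card → i ≤ L := by
    intro L i hi
    have hsub : ((S.filter fun σ => Kc U σ = L).image f).card ≤ 2 ^ L := by
      have h := Finset.card_le_card (s := (S.filter fun σ => Kc U σ = L).image f)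
        (t := Finset.univ.image fun v : List.Vector Bool L => v.toList) (by
          intro p hp
          obtain ⟨σ, hσ, rfl⟩ := Finset.mem_image.1 hp
          exact Finset.mem_image.2
            ⟨⟨f σ, (hfl σ).trans (Finset.mem_filter.1 hσ).2⟩, Finset.mem_univ _, rfl⟩)
      refine h.trans (Finset.card_image_le.trans ?_)
      simp [card_vector]
    rw [Finset.card_image_of_injective _ hfinj] at hsub
    exact (Nat.pow_le_pow_iff_right one_lt_two).1 (hi.trans hsub)
  have himg : S.image (Kc U) ⊆ Finset.Icc (KcNat U m - (C + 1)) (KcNat U m + c) := by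
    intro L hL
    obtain ⟨σ, hσ, rfl⟩ := Finset.mem_image.1 hL
    have := hfiber (Kc U σ) 0 (Finset.card_pos.2 ⟨σ, Finset.mem_filter.2 ⟨hσ, rfl⟩⟩)
    exact Finset.mem_Icc.2 ⟨by omega, (hS σ hσ).2⟩
  refine (Finset.card_le_mul_card_image (f := Kc U) S (2 ^ (c + C + 2)) fun L hL => ?_).trans ?_
  · by_contra! hlt
    have h₁ := hfiber L _ hlt.le
    have h₂ := hlen L _ hlt.le
    have := (Finset.mem_Icc.1 (himg hL)).2
    omega
  · refine Nat.mul_le_mul_left _ ((Finset.card_le_card himg).trans ?_)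
    rw [Nat.card_Icc]
    omega

end Counting

section InfinitelyOften

variable (U : UniversalPrefixMachine)

theorem length_restrict (A : Seq2) (n : ℕ) : (restrict A n).length = n := by simp [restrict]

theorem take_restrict (A : Seq2) {m n : ℕ} (h : m ≤ n) :
    (restrict A n).take m = restrict A m := by
  rw [restrict, ← List.map_take, List.take_range, min_eq_left h, restrict]

theorem restrict_eq_of_le {m n : ℕ} (h : m ≤ n) {A B : Seq2} (hAB : restrict A n = restrict B n) :
    restrict A m = restrict B m := by
  rw [← take_restrict A h, ← take_restrict B h, hAB]

theorem exists_Kc_restrict_strNum_le : ∃ C, ∀ (A : Seq2) (M : ℕ) (q : BinStr),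
    U.toPrefixOracleMachine.Computes zeroSeq q (restrict A M) → strNum q ≤ M →
      Kc U (restrict A (strNum q)) ≤ KcNat U (strNum q) + C := by
  let e : ℕ → Option (BinStr × BinStr) := fun s =>
    (zeroRun U s.unpair.1).bind fun x => (zeroRun U s.unpair.2).bind fun z =>
      if strNum z.1 = x.2.length then some (x.1, z.2.take x.2.length) else none
  have he : Computable e := by
    have h₁ : Computable fun s : ℕ => zeroRun U s.unpair.1 :=
      (computable_zeroRun U).comp (Computable.fst.comp Computable.unpair)
    have h₂ : Computable fun s : ℕ => zeroRun U s.unpair.2 :=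
      (computable_zeroRun U).comp (Computable.snd.comp Computable.unpair)
    have hlen : Primrec fun w : (BinStr × BinStr) × (BinStr × BinStr) => w.1.2.length :=
      Primrec.list_length.comp (Primrec.snd.comp Primrec.fst)
    have hG : Primrec fun w : (BinStr × BinStr) × (BinStr × BinStr) =>
        if strNum w.2.1 = w.1.2.length then some (w.1.1, w.2.2.take w.1.2.length) else none :=
      Primrec.ite (Primrec.eq.comp (primrec_strNum.comp (Primrec.fst.comp Primrec.snd)) hlen)
        (Primrec.option_some.comp (Primrec.pair (Primrec.fst.comp Primrec.fst)
          (Primrec.list_take.comp hlen (Primrec.snd.comp Primrec.snd)))) (Primrec.const none)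
    have hin : Computable fun w : ℕ × (BinStr × BinStr) => (zeroRun U w.1.unpair.2).bind fun z =>
        if strNum z.1 = w.2.2.length then some (w.2.1, z.2.take w.2.2.length) else none :=
      Computable.option_bind (h₂.comp Computable.fst) (hG.to_comp.comp (Computable.pair
        (Computable.snd.comp Computable.fst) Computable.snd)).to₂
    exact Computable.option_bind h₁ hin.to₂
  have hspec : ∀ {s p y}, e s = some (p, y) → ∃ x q z,
      U.toPrefixOracleMachine.Computes zeroSeq p x ∧
      U.toPrefixOracleMachine.Computes zeroSeq q z ∧
      strNum q = x.length ∧ y = z.take x.length := by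
    intro s p y h
    simp only [e, Option.bind_eq_some_iff] at h
    obtain ⟨⟨p', x⟩, hx, ⟨q, z⟩, hz, h⟩ := h
    split_ifs at h with hq
    simp only [Option.some.injEq, Prod.mk.injEq] at h
    obtain ⟨rfl, rfl⟩ := h
    exact ⟨x, q, z, (computes_zeroSeq_iff U).2 ⟨_, hx⟩, (computes_zeroSeq_iff U).2 ⟨_, hz⟩, hq, rfl⟩
  obtain ⟨C, hC⟩ := exists_Kc_le_of_enum U e he (by
    intro s t p₁ y₁ p₂ y₂ h₁ h₂ hp
    obtain ⟨x₁, q₁, z₁, hx₁, hz₁, hq₁, rfl⟩ := hspec h₁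
    obtain ⟨x₂, q₂, z₂, hx₂, hz₂, hq₂, rfl⟩ := hspec h₂
    obtain ⟨rfl, rfl⟩ := computes_unique U hx₁ hx₂ hp
    obtain rfl := strNum_injective (hq₁.trans hq₂.symm)
    obtain ⟨-, rfl⟩ := computes_unique U hz₁ hz₂ List.prefix_rfl
    exact ⟨rfl, rfl⟩)
  refine ⟨C, fun A M q hq hM => ?_⟩
  obtain ⟨p, hp, hpl⟩ := exists_length_eq_Kc U (List.replicate (strNum q) false)
  obtain ⟨s, hs⟩ := (computes_zeroSeq_iff U).1 hp
  obtain ⟨t, ht⟩ := (computes_zeroSeq_iff U).1 hq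
  have := hC (Nat.pair s t) p (restrict A (strNum q)) (by simp [e, hs, ht, take_restrict A hM])
  rwa [hpl] at this

theorem exists_KcNat_pow_le : ∃ C, ∀ d, KcNat U (8 ^ d) ≤ d + 1 + C := by
  have hR : Primrec fun d : ℕ => some (d + 1, List.replicate (8 ^ d) false) :=
    Primrec.option_some.comp (Primrec.pair Primrec.succ ((Primrec.list_replicate false).comp
      (Primrec.nat_pow.comp (Primrec.const 8) Primrec.id)))
  obtain ⟨C, hC⟩ := exists_Kc_le_of_requests _ U hR.to_comp (fun s => by
    have : ∑ t ∈ Finset.range s, requestWeight (some (t + 1, List.replicate (8 ^ t) false)) =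
        1 - (1 / 2) ^ s := by
      induction s with
      | zero => simp
      | succ s ih =>
        rw [Finset.sum_range_succ, ih]
        change _ + (1 / 2 : ℝ) ^ (s + 1) = _
        ring
    rw [this]
    linarith [show (0 : ℝ) ≤ (1 / 2) ^ s by positivity])
  exact ⟨C, fun d => hC d _ _ rfl⟩

theorem delta02Fun_log {b : ℕ} (hb : 1 < b) : Delta02Fun (Nat.log b) :=
  ⟨fun _ x => Nat.log b x, ((Primrec.nat_log hb).comp Primrec.snd).to_comp.to₂,
    fun _ => ⟨0, fun _ _ => rfl⟩⟩

theorem isOrder_log {b : ℕ} (hb : 1 < b) : IsOrder (Nat.log b) :=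
  ⟨Nat.log_monotone, fun k => ⟨b ^ (k + 1), by rw [Nat.log_pow hb]; omega⟩⟩

/-- Reals that are K-trivial up to every Δ⁰₂ order are infinitely often K-trivial. -/
theorem KTDelta.infOftenKTrivial {A : Seq2} (h : KTDelta U A) : InfOftenKTrivial U A := by
  obtain ⟨c, hc⟩ := h _ (delta02Fun_log (by norm_num : 1 < 8)) (isOrder_log (by norm_num))
  obtain ⟨C₁, hC₁⟩ := exists_KcNat_pow_le U
  obtain ⟨C₂, hC₂⟩ := exists_Kc_restrict_strNum_le U
  choose q hq hql using fun d => exists_length_eq_Kc U (restrict A (8 ^ d))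
  have hinj : Function.Injective fun d => strNum (q d) := fun d d' hd => by
    have hd := strNum_injective hd
    have := congrArg List.length (computes_unique U (hq d) (hq d') (hd ▸ List.prefix_rfl)).2
    rw [length_restrict, length_restrict] at this
    exact Nat.pow_right_injective (by norm_num : 2 ≤ 8) this
  refine ⟨C₂, ((Set.Ici_infinite (C₁ + c + 2)).image hinj.injOn).mono ?_⟩
  rintro _ ⟨d, hd, rfl⟩
  refine hC₂ A (8 ^ d) (q d) (hq d) ?_
  have h₁ := hc (8 ^ d)
  have h₂ := hC₁ d
  rw [Nat.log_pow (by norm_num)] at h₁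
  have hd : C₁ + c + 2 ≤ d := hd
  calc strNum (q d) ≤ 2 ^ ((q d).length + 1) := by have := strNum_add_two_le (q d); omega
    _ ≤ 2 ^ (3 * d) := Nat.pow_le_pow_right (by norm_num) (by rw [hql]; omega)
    _ = 8 ^ d := by rw [pow_mul]; norm_num

/-- A set of reals with boundedly many initial segments of infinitely many lengths is finite. -/
theorem finite_of_card_restrict_le {S : Set Seq2} {D : ℕ} {I : Set ℕ} (hI : I.Infinite)
    (h : ∀ m ∈ I, ∀ T : Finset Seq2, ↑T ⊆ S → (T.image fun B => restrict B m).card ≤ D) :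
    S.Finite := by
  by_contra hS
  obtain ⟨T, hT, hcard⟩ := Set.Infinite.exists_subset_card_eq hS (D + 1)
  have hsep : ∀ B B' : Seq2, B ≠ B' → ∃ n, restrict B n ≠ restrict B' n := fun B B' hne => by
    obtain ⟨n, hn⟩ := Function.ne_iff.1 hne
    refine ⟨n + 1, fun heq => hn ?_⟩
    simp only [restrict, List.map_inj_left, List.mem_range] at heq
    exact heq n n.lt_succ_self
  choose! f hf using hsep
  obtain ⟨m, hm, hlt⟩ := hI.exists_gt ((T ×ˢ T).sup fun x => f x.1 x.2)
  have := h m hm T hT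
  rw [Finset.card_image_of_injOn, hcard] at this
  · omega
  · intro B hB B' hB' heq
    by_contra hne
    exact hf B B' hne (restrict_eq_of_le ((Finset.le_sup (f := fun x : Seq2 × Seq2 => f x.1 x.2)
      (Finset.mk_mem_product hB hB')).trans hlt.le) heq)

/-- Infinitely often K-trivial reals have countable lower cones in the K-degrees. -/
theorem InfOftenKTrivial.countable_setOf_KLE {A : Seq2} (h : InfOftenKTrivial U A) :
    {B : Seq2 | KLE U B A}.Countable := by
  obtain ⟨c₀, hI⟩ := h
  have heq : {B : Seq2 | KLE U B A} =
      ⋃ c : ℕ, {B | ∀ n, Kc U (restrict B n) ≤ Kc U (restrict A n) + c} := by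
    ext B
    simp [KLE]
  rw [heq]
  refine Set.countable_iUnion fun c => Set.Finite.countable ?_
  obtain ⟨D, hD⟩ := exists_card_le_of_Kc_le U (c₀ + c)
  refine finite_of_card_restrict_le (D := D) hI fun m hm T hT => hD m _ fun σ hσ => ?_
  obtain ⟨B, hB, rfl⟩ := Finset.mem_image.1 hσ
  have h₁ := hT hB m
  have h₂ : Kc U (restrict A m) ≤ KcNat U m + c₀ := hm
  exact ⟨length_restrict B m, by omega⟩

end InfinitelyOften

/-- every real in KT(Δ⁰₂) has a countable lower cone in the K-degrees. -/
theorem stmt15 (U : UniversalPrefixMachine) (A : Seq2) (h : KTDelta U A) :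
    {B : Seq2 | KLE U B A}.Countable := by
  exact (h.infOftenKTrivial U).countable_setOf_KLE U
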